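/- arXiv:1307.0171 — 3 statements merged into one kernel-verified Lean document; each statement's English description precedes it below -/
import Mathlib

section
/- Let A be an n×n complex matrix, B an n×m complex matrix, K an m×n complex matrix, C a p×n complex matrix and L an n×p complex matrix, and let M be the 2n×2n block matrix M = [[A, B·K],[-L·C, A+B·K+L·C]]. Then the spectrum of M equals the union of the spectrum of A+B·K and the spectrum of A+L·C. -/
/-- The spectrum of a block upper triangular matrix is the union of the spectra of its
diagonal blocks. -/
theorem Matrix.spectrum_fromBlocks_zero₂₁ {R m n : Type*} [CommRing R] [Fintype m] [Fintype n]
    [DecidableEq m] [DecidableEq n] (A : Matrix m m R) (B : Matrix m n R) (D : Matrix n n R) :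
    spectrum R (Matrix.fromBlocks A B 0 D) = spectrum R A ∪ spectrum R D := by
  ext μ
  have h : algebraMap R (Matrix (m ⊕ n) (m ⊕ n) R) μ - Matrix.fromBlocks A B 0 D =
      Matrix.fromBlocks (algebraMap R _ μ - A) (-B) 0 (algebraMap R _ μ - D) := by
    simp only [Algebra.algebraMap_eq_smul_one, ← Matrix.fromBlocks_one, Matrix.fromBlocks_smul,
      sub_eq_add_neg, Matrix.fromBlocks_neg, Matrix.fromBlocks_add, smul_zero, zero_add, neg_zero]
  rw [Set.mem_union, spectrum.mem_iff, spectrum.mem_iff, spectrum.mem_iff, h,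
    Matrix.isUnit_fromBlocks_zero₂₁, not_and_or]

/-- The spectrum of the observer-based closed-loop block matrix
`M = [[A, BK],[-LC, A+BK+LC]]` equals `spectrum (A+BK) ∪ spectrum (A+LC)`. -/
theorem spectrum_closedLoop_block (n m p : ℕ)
    (A : Matrix (Fin n) (Fin n) ℂ) (B : Matrix (Fin n) (Fin m) ℂ)
    (K : Matrix (Fin m) (Fin n) ℂ) (C : Matrix (Fin p) (Fin n) ℂ)
    (L : Matrix (Fin n) (Fin p) ℂ) :
    spectrum ℂ (Matrix.fromBlocks A (B * K) (-(L * C)) (A + B * K + L * C)) =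
      spectrum ℂ (A + B * K) ∪ spectrum ℂ (A + L * C) := by
  let u : (Matrix (Fin n ⊕ Fin n) (Fin n ⊕ Fin n) ℂ)ˣ :=
    { val := Matrix.fromBlocks 1 0 (-1) 1
      inv := Matrix.fromBlocks 1 0 1 1
      val_inv := by simp [Matrix.fromBlocks_multiply]
      inv_val := by simp [Matrix.fromBlocks_multiply] }
  have h : (u : Matrix (Fin n ⊕ Fin n) (Fin n ⊕ Fin n) ℂ) *
      Matrix.fromBlocks A (B * K) (-(L * C)) (A + B * K + L * C) * (u⁻¹ : _ˣ) =
      Matrix.fromBlocks (A + B * K) (B * K) 0 (A + L * C) := by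
    change Matrix.fromBlocks 1 0 (-1) 1 * _ * Matrix.fromBlocks 1 0 1 1 = _
    simp only [Matrix.fromBlocks_multiply, Matrix.one_mul, Matrix.mul_one, Matrix.zero_mul,
      Matrix.mul_zero, Matrix.neg_mul]
    congr 1 <;> abel
  rw [← spectrum.units_conjugate (u := u), h, Matrix.spectrum_fromBlocks_zero₂₁]
end

section
/- Let A be an n×n real matrix, B an n×m real matrix, K an m×n real matrix, C a p×n real matrix and L an n×p real matrix. If both A+B·K and A+L·C are Hurwitz, then the 2n×2n block matrix M = [[A, B·K],[-L·C, A+B·K+L·C]] is Hurwitz. -/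
/-- A square real matrix is Hurwitz if every eigenvalue of the matrix viewed as a
complex matrix has strictly negative real part. -/
def IsHurwitz {n : Type*} [Fintype n] [DecidableEq n] (M : Matrix n n ℝ) : Prop :=
  ∀ μ ∈ spectrum ℂ (M.map (algebraMap ℝ ℂ)), μ.re < 0

/-- Being Hurwitz depends only on the complex roots of the characteristic polynomial. -/
lemma isHurwitz_iff_charpoly {n : Type*} [Fintype n] [DecidableEq n] (M : Matrix n n ℝ) :
    IsHurwitz M ↔ ∀ μ : ℂ, (M.charpoly.map (algebraMap ℝ ℂ)).IsRoot μ → μ.re < 0 := by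
  simp only [IsHurwitz, Matrix.mem_spectrum_iff_isRoot_charpoly, Matrix.charpoly_map]

/-- A block upper triangular matrix with Hurwitz diagonal blocks is Hurwitz. -/
lemma IsHurwitz.fromBlocks_zero₂₁ {m n : Type*} [Fintype m] [DecidableEq m]
    [Fintype n] [DecidableEq n] {P : Matrix m m ℝ} {S : Matrix n n ℝ}
    (hP : IsHurwitz P) (hS : IsHurwitz S) (Q : Matrix m n ℝ) :
    IsHurwitz (Matrix.fromBlocks P Q 0 S) := by
  rw [isHurwitz_iff_charpoly] at *
  intro μ hμ
  rw [Matrix.charpoly_fromBlocks_zero₂₁, Polynomial.map_mul, Polynomial.IsRoot.def,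
    Polynomial.eval_mul, mul_eq_zero] at hμ
  exact hμ.elim (hP μ) (hS μ)

/-- Subtracting the first block coordinate from the second preserves the characteristic
polynomial. -/
lemma Matrix.charpoly_fromBlocks_shear {R n : Type*} [CommRing R] [Fintype n] [DecidableEq n]
    (P Q S T : Matrix n n R) :
    (Matrix.fromBlocks P Q S T).charpoly =
      (Matrix.fromBlocks (P + Q) Q (S + T - (P + Q)) (T - Q)).charpoly := by
  let U : (Matrix (n ⊕ n) (n ⊕ n) R)ˣ :=
    { val := Matrix.fromBlocks 1 0 (-1) 1
      inv := Matrix.fromBlocks 1 0 1 1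
      val_inv := by simp [Matrix.fromBlocks_multiply]
      inv_val := by simp [Matrix.fromBlocks_multiply] }
  rw [← Matrix.charpoly_units_conj U, ← Matrix.coe_units_inv]
  congr 1
  change Matrix.fromBlocks 1 0 (-1) 1 * Matrix.fromBlocks P Q S T *
    Matrix.fromBlocks 1 0 1 1 = _
  simp only [Matrix.fromBlocks_multiply, Matrix.one_mul, Matrix.mul_one, Matrix.zero_mul,
    Matrix.mul_zero, Matrix.neg_mul, add_zero, zero_add]
  congr 1 <;> abel

/-- If `A + BK` and `A + LC` are Hurwitz, then the observer-based closed-loop block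
matrix `M = [[A, BK],[-LC, A+BK+LC]]` (equation (III23)) is Hurwitz. -/
theorem closedLoop_block_isHurwitz (n m p : ℕ)
    (A : Matrix (Fin n) (Fin n) ℝ) (B : Matrix (Fin n) (Fin m) ℝ)
    (K : Matrix (Fin m) (Fin n) ℝ) (C : Matrix (Fin p) (Fin n) ℝ)
    (L : Matrix (Fin n) (Fin p) ℝ)
    (hK : IsHurwitz (A + B * K)) (hL : IsHurwitz (A + L * C)) :
    IsHurwitz (Matrix.fromBlocks A (B * K) (-(L * C)) (A + B * K + L * C)) := by
  have h := hK.fromBlocks_zero₂₁ hL (B * K)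
  rw [isHurwitz_iff_charpoly] at h ⊢
  rw [Matrix.charpoly_fromBlocks_shear]
  convert h using 6 <;> abel
end

section
/- Let P, A, N be n×n real matrices and ε₁, κ, μ, ε₂, d real numbers with κ > 0, μ > 0, d ≥ 0 and ε₂ ≥ 1/√μ. Assume: (i) P is symmetric and xᵀPx ≥ μ‖x‖² for all x ∈ ℝⁿ; (ii) ‖Px‖ ≤ κ‖x‖ for all x; (iii) xᵀ(P·A + Aᵀ·P + 2ε₁·P)x ≤ −‖x‖² for all x; (iv) ‖Nx‖ ≤ ‖x‖/(2κ) for all x; and (v) b ∈ ℝⁿ satisfies ‖b‖ ≤ d/κ. Then for every e ∈ ℝⁿ, 2·eᵀP(A·e + N·e + b) ≤ −2ε₁·(eᵀP e) + 2ε₂·√(eᵀP e)·d. -/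
open Matrix

/-- The Euclidean norm of a vector in `ℝⁿ`. -/
noncomputable def euclNorm {n : ℕ} (v : Fin n → ℝ) : ℝ :=
  ‖(WithLp.equiv 2 (Fin n → ℝ)).symm v‖

/-- The Cauchy–Schwarz inequality for the dot product. -/
theorem dotProduct_le_euclNorm_mul {n : ℕ} (v w : Fin n → ℝ) :
    v ⬝ᵥ w ≤ euclNorm v * euclNorm w := by
  have h := real_inner_le_norm (WithLp.toLp 2 w) (WithLp.toLp 2 v)
  rw [EuclideanSpace.inner_toLp_toLp, mul_comm] at h
  simpa [euclNorm] using h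

theorem euclNorm_nonneg {n : ℕ} (v : Fin n → ℝ) : 0 ≤ euclNorm v :=
  norm_nonneg _

theorem Matrix.IsSymm.dotProduct_mulVec_comm {n : ℕ} {P : Matrix (Fin n) (Fin n) ℝ}
    (hP : P.IsSymm) (v w : Fin n → ℝ) : v ⬝ᵥ (P *ᵥ w) = (P *ᵥ v) ⬝ᵥ w := by
  rw [dotProduct_mulVec, ← mulVec_transpose, hP.eq]

/-- The derivative estimate for the quadratic Lyapunov function `V = eᵀPe` in the
proof of Lemma 3:
`2 eᵀP(Ae + Ne + b) ≤ −2ε₁ (eᵀPe) + 2ε₂ √(eᵀPe) d`. -/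
theorem lyapunov_derivative_estimate (n : ℕ)
    (P A N : Matrix (Fin n) (Fin n) ℝ) (ε₁ κ μ ε₂ d : ℝ) (b : Fin n → ℝ)
    (hκ : 0 < κ) (hμ : 0 < μ) (hd : 0 ≤ d) (hε₂ : 1 / Real.sqrt μ ≤ ε₂)
    (hPsymm : P.IsSymm)
    (hPlow : ∀ x : Fin n → ℝ, μ * euclNorm x ^ 2 ≤ x ⬝ᵥ (P *ᵥ x))
    (hPup : ∀ x : Fin n → ℝ, euclNorm (P *ᵥ x) ≤ κ * euclNorm x)
    (hLyap : ∀ x : Fin n → ℝ,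
      x ⬝ᵥ ((P * A + Aᵀ * P + (2 * ε₁) • P) *ᵥ x) ≤ -(euclNorm x ^ 2))
    (hN : ∀ x : Fin n → ℝ, euclNorm (N *ᵥ x) ≤ euclNorm x / (2 * κ))
    (hb : euclNorm b ≤ d / κ) :
    ∀ e : Fin n → ℝ,
      2 * (e ⬝ᵥ (P *ᵥ (A *ᵥ e + N *ᵥ e + b))) ≤
        -2 * ε₁ * (e ⬝ᵥ (P *ᵥ e)) + 2 * ε₂ * Real.sqrt (e ⬝ᵥ (P *ᵥ e)) * d := by
  intro e
  have hLyap_e : 2 * (e ⬝ᵥ (P *ᵥ (A *ᵥ e))) + 2 * ε₁ * (e ⬝ᵥ (P *ᵥ e)) ≤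
      -(euclNorm e ^ 2) := by
    have hA : e ⬝ᵥ (Aᵀ *ᵥ (P *ᵥ e)) = e ⬝ᵥ (P *ᵥ (A *ᵥ e)) := by
      rw [hPsymm.dotProduct_mulVec_comm, dotProduct_mulVec, vecMul_transpose,
        dotProduct_comm]
    have h := hLyap e
    simp only [add_mulVec, dotProduct_add, smul_mulVec, dotProduct_smul, smul_eq_mul,
      ← mulVec_mulVec, hA] at h
    linarith
  have hPe : ∀ (v : Fin n → ℝ) (c : ℝ), euclNorm v ≤ c →
      e ⬝ᵥ (P *ᵥ v) ≤ κ * euclNorm e * c := fun v c hv => by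
    rw [hPsymm.dotProduct_mulVec_comm]
    exact (dotProduct_le_euclNorm_mul _ _).trans
      (mul_le_mul (hPup e) hv (euclNorm_nonneg v)
        (mul_nonneg hκ.le (euclNorm_nonneg e)))
  have hNe : 2 * (e ⬝ᵥ (P *ᵥ (N *ᵥ e))) ≤ euclNorm e ^ 2 := by
    have h := hPe _ _ (hN e)
    have h_eq : κ * euclNorm e * (euclNorm e / (2 * κ)) = euclNorm e ^ 2 / 2 := by
      field_simp
    linarith
  have hbe : e ⬝ᵥ (P *ᵥ b) ≤ euclNorm e * d := by
    have h := hPe _ _ hb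
    have h_eq : κ * euclNorm e * (d / κ) = euclNorm e * d := by
      field_simp
    linarith
  have he : euclNorm e ≤ ε₂ * √(e ⬝ᵥ (P *ᵥ e)) := by
    have hsqrt : √μ * euclNorm e ≤ √(e ⬝ᵥ (P *ᵥ e)) := by
      rw [← Real.sqrt_sq (euclNorm_nonneg e), ← Real.sqrt_mul hμ.le]
      exact Real.sqrt_le_sqrt (hPlow e)
    calc euclNorm e ≤ 1 / √μ * √(e ⬝ᵥ (P *ᵥ e)) := by
          rw [one_div_mul_eq_div, le_div_iff₀ (Real.sqrt_pos.2 hμ), mul_comm]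
          exact hsqrt
      _ ≤ ε₂ * √(e ⬝ᵥ (P *ᵥ e)) := by gcongr
  have hed := mul_le_mul_of_nonneg_right he hd
  simp only [mulVec_add, dotProduct_add]
  linarith
end
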